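/- Let p, q be coprime odd integers with 0 < q < p, with sequences P_k, Q_k as above, and let ℓ′ be the unique odd integer with 0 < ℓ′ < 2p and qℓ′ ≡ −1 (mod 2p). Then, modulo P_{p−1} in ℚ[X], one has P_{ℓ′−1} · ( Q_{p−2} − X · Σ_{k=1}^{(p−1)/2} ε_{2k−1} (P_{2k−1} + P_{2k−3}) ) ≡ 2. (This expresses that the Reidemeister torsion τ₁ of K(p,q) at parabolic representations equals 2/(x² P_{ℓ−1}).) -/

import Mathlib

open Polynomial

/-- `ε_k = (−1)^⌊kq/p⌋` (for `p > 0`, `Int.fdiv` is the floor of the rational `kq/p`). -/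
def eps (p q k : ℤ) : ℤ := (((-1 : ℤˣ) ^ ((k * q).fdiv p) : ℤˣ) : ℤ)

lemma tt_eps_pos (p q k t s : ℤ) (h : k * q = 2 * p * t + s) (h0 : 0 ≤ s) (h1 : s < p) :
    eps p q k = 1 := by
  have hp : 0 < p := by omega
  have : (k * q).fdiv p = 2 * t := by
    rw [Int.fdiv_eq_ediv_of_nonneg _ hp.le]
    rw [Int.ediv_eq_iff_of_pos hp]
    constructor <;> nlinarith
  unfold eps
  rw [this, zpow_mul]
  simp

lemma tt_eps_neg (p q k t s : ℤ) (h : k * q = 2 * p * t + s) (h0 : p ≤ s) (h1 : s < 2 * p) :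
    eps p q k = -1 := by
  have hp : 0 < p := by omega
  have : (k * q).fdiv p = 2 * t + 1 := by
    rw [Int.fdiv_eq_ediv_of_nonneg _ hp.le]
    rw [Int.ediv_eq_iff_of_pos hp]
    constructor <;> nlinarith
  unfold eps
  rw [this, zpow_add, zpow_mul]
  simp

lemma tt_decomp (p n : ℤ) (hp : 0 < p) : ∃ t s, n = 2 * p * t + s ∧ 0 ≤ s ∧ s < 2 * p :=
  ⟨n / (2 * p), n % (2 * p), (Int.mul_ediv_add_emod n (2 * p)).symm,
    Int.emod_nonneg _ (by omega), Int.emod_lt_of_pos _ (by omega)⟩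

lemma tt_eps_zero (p q : ℤ) (hp : 0 < p) : eps p q 0 = 1 :=
  tt_eps_pos p q 0 0 0 (by ring) le_rfl hp

lemma tt_eps_add_p (p q k : ℤ) (hp : 0 < p) (hq : Odd q) : eps p q (k + p) = - eps p q k := by
  obtain ⟨t, s, h, h0, h1⟩ := tt_decomp p (k * q) hp
  obtain ⟨u, hu⟩ := hq
  by_cases hs : s < p
  · rw [tt_eps_pos p q k t s h h0 hs,
      tt_eps_neg p q (k + p) (t + u) (s + p) (by rw [add_mul, h, hu]; ring) (by omega) (by omega)]
  · rw [tt_eps_neg p q k t s h (by omega) h1,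
      tt_eps_pos p q (k + p) (t + u + 1) (s - p) (by rw [add_mul, h, hu]; ring)
        (by omega) (by omega)]
    rfl

lemma tt_ne (p q k t s : ℤ) (hcop : IsCoprime p q) (hk : ¬ p ∣ k) (h : k * q = 2 * p * t + s) :
    s ≠ 0 ∧ s ≠ p := by
  constructor
  · rintro rfl
    exact hk (hcop.dvd_of_dvd_mul_right ⟨2 * t, by rw [h]; ring⟩)
  · rintro rfl
    exact hk (hcop.dvd_of_dvd_mul_right ⟨2 * t + 1, by rw [h]; ring⟩)

lemma tt_eps_neg_arg (p q k : ℤ) (hp : 0 < p) (hcop : IsCoprime p q) (hk : ¬ p ∣ k) :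
    eps p q (-k) = - eps p q k := by
  obtain ⟨t, s, h, h0, h1⟩ := tt_decomp p (k * q) hp
  obtain ⟨hs0, hsp⟩ := tt_ne p q k t s hcop hk h
  by_cases hs : s < p
  · rw [tt_eps_pos p q k t s h h0 hs,
      tt_eps_neg p q (-k) (-t - 1) (2 * p - s) (by rw [neg_mul, h]; ring) (by omega) (by omega)]
  · rw [tt_eps_neg p q k t s h (by omega) h1,
      tt_eps_pos p q (-k) (-t - 1) (2 * p - s) (by rw [neg_mul, h]; ring)
        (by omega) (by omega)]
    rfl

lemma tt_eps_shift (p q l k : ℤ) (hp : 0 < p) (hcop : IsCoprime p q) (hl : 2 * p ∣ q * l + 1)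
    (hk : ¬ p ∣ k) : eps p q (k + l) = eps p q k := by
  obtain ⟨t, s, h, h0, h1⟩ := tt_decomp p (k * q) hp
  obtain ⟨hs0, hsp⟩ := tt_ne p q k t s hcop hk h
  obtain ⟨u, hu⟩ := hl
  have e : (k + l) * q = 2 * p * (t + u) + (s - 1) := by linear_combination h + hu
  by_cases hs : s < p
  · rw [tt_eps_pos p q k t s h h0 hs, tt_eps_pos p q _ _ _ e (by omega) (by omega)]
  · rw [tt_eps_neg p q k t s h (by omega) h1, tt_eps_neg p q _ _ _ e (by omega) (by omega)]

lemma tt_eps_l (p q l : ℤ) (hp : 1 < p) (hl : 2 * p ∣ q * l + 1) : eps p q l = -1 := by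
  obtain ⟨u, hu⟩ := hl
  exact tt_eps_neg p q l (u - 1) (2 * p - 1) (by linear_combination hu) (by omega) (by omega)

/-- uniqueness on an initial segment -/
lemma tt_uniq {R : Type*} [CommRing R] (c A B : ℤ → R) (n : ℤ)
    (hA : ∀ k, 1 ≤ k → k ≤ n → A k = c k * A (k - 1) + A (k - 2))
    (hB : ∀ k, 1 ≤ k → k ≤ n → B k = c k * B (k - 1) + B (k - 2))
    (h0 : A 0 = B 0) (h1 : A (-1) = B (-1)) (k : ℤ) (hk : -1 ≤ k) (hkn : k ≤ n) : A k = B k := by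
  have key : ∀ m : ℕ, ((m : ℤ) - 1 ≤ n → A ((m : ℤ) - 1) = B ((m : ℤ) - 1)) ∧
      ((m : ℤ) ≤ n → A m = B m) := by
    intro m
    induction m with
    | zero => simp [h0, h1]
    | succ m ih =>
      push_cast
      simp only [add_sub_cancel_right]
      refine ⟨ih.2, fun h => ?_⟩
      rw [hA _ (by omega) h, hB _ (by omega) h]
      have e1 : (m : ℤ) + 1 - 1 = m := by ring
      have e2 : (m : ℤ) + 1 - 2 = m - 1 := by ring
      rw [e1, e2, ih.1 (by omega), ih.2 (by omega)]
  have := (key (k + 1).toNat).1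
  rw [Int.toNat_of_nonneg (by omega)] at this
  simpa using this (by omega)

/-- uniqueness on all integers -/
lemma tt_uniq_all {R : Type*} [CommRing R] (c A B : ℤ → R)
    (hA : ∀ k, A k = c k * A (k - 1) + A (k - 2))
    (hB : ∀ k, B k = c k * B (k - 1) + B (k - 2))
    (h0 : A 0 = B 0) (h1 : A (-1) = B (-1)) (k : ℤ) : A k = B k := by
  suffices h : A (k - 1) = B (k - 1) ∧ A k = B k from h.2
  induction k using Int.induction_on with
  | zero => simpa using ⟨h1, h0⟩
  | succ i ih =>
    refine ⟨by simpa using ih.2, ?_⟩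
    rw [hA, hB]
    have e1 : (i : ℤ) + 1 - 1 = i := by ring
    have e2 : (i : ℤ) + 1 - 2 = i - 1 := by ring
    rw [e1, e2, ih.1, ih.2]
  | pred i ih =>
    refine ⟨?_, ih.1⟩
    have a := hA (-(i : ℤ))
    have b := hB (-(i : ℤ))
    rw [ih.1, ih.2] at a
    have e2 : -(i : ℤ) - 1 - 1 = -i - 2 := by ring
    rw [e2]
    linear_combination b - a

lemma tt_bij (p c : ℤ) (hp : Odd p) (hp0 : 0 < p) (hc : Odd c) (hcop : IsCoprime p c) (j : ℤ)
    (hj : 1 ≤ j ∧ j ≤ (p - 1) / 2) :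
    ∃ i : ℤ, (1 ≤ i ∧ i ≤ (p - 1) / 2) ∧
      (2 * p ∣ (2 * j - 1) * c - (2 * i - 1) ∨ 2 * p ∣ (2 * j - 1) * c + (2 * i - 1)) := by
  obtain ⟨t, s, h, h0, h1⟩ := tt_decomp p ((2 * j - 1) * c) hp0
  have hnd : ¬ p ∣ (2 * j - 1) := by
    intro hd
    have := Int.le_of_dvd (by omega) hd
    omega
  obtain ⟨hs0, hsp⟩ := tt_ne p c _ t s hcop hnd h
  have hodd : Odd s := by
    have h2 : Odd ((2 * j - 1) * c) := Odd.mul ⟨j - 1, by ring⟩ hc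
    rw [h] at h2
    have h3 : Even (2 * p * t) := ⟨p * t, by ring⟩
    by_contra hne
    rw [Int.not_odd_iff_even] at hne
    exact (Int.not_odd_iff_even.2 (h3.add hne)) h2
  obtain ⟨u, hu⟩ := hodd
  obtain ⟨m, hm⟩ := hp
  by_cases hs : s < p
  · exact ⟨u + 1, ⟨by omega, by omega⟩, Or.inl ⟨t, by rw [h, hu]; ring⟩⟩
  · exact ⟨p - u, ⟨by omega, by omega⟩, Or.inr ⟨t + 1, by rw [h, hu]; ring⟩⟩

lemma tt_bij_inv (p q l j i j' : ℤ) (hj : 1 ≤ j ∧ j ≤ (p - 1) / 2)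
    (hj' : 1 ≤ j' ∧ j' ≤ (p - 1) / 2) (hl : 2 * p ∣ q * l + 1)
    (h1 : 2 * p ∣ (2 * j - 1) * q - (2 * i - 1) ∨ 2 * p ∣ (2 * j - 1) * q + (2 * i - 1))
    (h2 : 2 * p ∣ (2 * i - 1) * l - (2 * j' - 1) ∨ 2 * p ∣ (2 * i - 1) * l + (2 * j' - 1)) :
    j' = j := by
  have key : 2 * p ∣ (2 * j - 1) + (2 * j' - 1) ∨ 2 * p ∣ (2 * j - 1) - (2 * j' - 1) := by
    obtain ⟨u, hu⟩ := hl
    rcases h1 with ⟨v, hv⟩ | ⟨v, hv⟩ <;> rcases h2 with ⟨w, hw⟩ | ⟨w, hw⟩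
    · exact Or.inl ⟨(2 * j - 1) * u - v * l - w, by
        linear_combination (2 * j - 1) * hu - l * hv - hw⟩
    · exact Or.inr ⟨(2 * j - 1) * u - v * l - w, by
        linear_combination (2 * j - 1) * hu - l * hv - hw⟩
    · exact Or.inr ⟨(2 * j - 1) * u - v * l + w, by
        linear_combination (2 * j - 1) * hu - l * hv + hw⟩
    · exact Or.inl ⟨(2 * j - 1) * u - v * l + w, by
        linear_combination (2 * j - 1) * hu - l * hv + hw⟩
  rcases key with h | h
  · have := Int.le_of_dvd (by omega) h
    omega
  · have := Int.eq_zero_of_abs_lt_dvd h (by rw [abs_lt]; constructor <;> omega)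
    omega

/-- telescoping -/
lemma tt_tele {R : Type*} [CommRing R] (F : ℤ → R) (m : ℕ) :
    ∑ j ∈ Finset.Icc (1 : ℤ) m, (F (2 * j - 2) - F (2 * j)) = F 0 - F (2 * m) := by
  induction m with
  | zero => simp
  | succ m ih =>
    have : Finset.Icc (1 : ℤ) ((m + 1 : ℕ) : ℤ) = insert ((m : ℤ) + 1) (Finset.Icc (1 : ℤ) m) := by
      ext a; simp; omega
    rw [this, Finset.sum_insert (by simp), ih]
    push_cast
    have e : 2 * ((m : ℤ) + 1) - 2 = 2 * m := by ring
    rw [e]; ring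

lemma tt_sum {R : Type*} [CommRing R] (p q l : ℤ) (hp : Odd p) (hp1 : 1 < p) (hq : Odd q)
    (hcop : IsCoprime p q) (hlo : Odd l) (hl : 2 * p ∣ q * l + 1) (L : ℤ → R)
    (hper : ∀ k m : ℤ, L (k + 2 * p * m) = L k) (heven : ∀ k, L (-k) = L k) :
    ∑ j ∈ Finset.Icc (1 : ℤ) ((p - 1) / 2), (eps p q (2 * j - 1) : R) *
      (L (2 * j - 1 + l) - L (2 * j - 1 - l)) = L 0 - L (p + l) := by
  have hcl : IsCoprime p l := by
    obtain ⟨u, hu⟩ := hl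
    exact ⟨2 * u, -q, by linear_combination -hu⟩
  have hmod : ∀ a b : ℤ, 2 * p ∣ a - b → L a = L b := by
    rintro a b ⟨m, hm⟩
    rw [← hper b m, ← hm]; congr 1; ring
  have hp0 : 0 < p := by omega
  choose! f hf using fun j hj => tt_bij p q hp hp0 hq hcop j hj
  choose! g hg using fun j hj => tt_bij p l hp hp0 hlo hcl j hj
  have hswap : 2 * p ∣ l * q + 1 := by rwa [mul_comm l q]
  obtain ⟨m, hm⟩ := hp
  have hm0 : 0 ≤ m := by omega
  lift m to ℕ using hm0
  have hmm : (p - 1) / 2 = (m : ℤ) := by omega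
  have tele := tt_tele (fun r => L (-l * r)) m
  have e0 : L (-l * 0) = L 0 := by simp
  have e1 : L (-l * (2 * m)) = L (p + l) := by
    apply hmod
    obtain ⟨v, hv⟩ := hlo
    refine ⟨-v - 1, ?_⟩
    rw [hm, hv]; ring
  simp only [e0, e1] at tele
  rw [← tele, ← hmm]
  refine Finset.sum_nbij' f g ?_ ?_ ?_ ?_ ?_
  · intro j hj
    rw [Finset.mem_Icc] at *
    exact (hf j hj).1
  · intro j hj
    rw [Finset.mem_Icc] at *
    exact (hg j hj).1
  · intro j hj
    rw [Finset.mem_Icc] at *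
    have a := hf j hj
    have b := hg (f j) a.1
    exact tt_bij_inv p q l j (f j) _ hj b.1 hl a.2 b.2
  · intro j hj
    rw [Finset.mem_Icc] at *
    have a := hg j hj
    have b := hf (g j) a.1
    exact tt_bij_inv p l q j (g j) _ hj b.1 hswap a.2 b.2
  · intro j hj
    rw [Finset.mem_Icc] at hj
    obtain ⟨⟨b1, b2⟩, h⟩ := hf j hj
    obtain ⟨u, hu⟩ := hl
    rcases h with ⟨v, hv⟩ | ⟨v, hv⟩
    · rw [tt_eps_pos p q (2 * j - 1) v (2 * f j - 1) (by linear_combination hv) (by omega)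
        (by omega)]
      have x1 : L (2 * j - 1 + l) = L (-l * (2 * f j - 2)) := hmod _ _
        ⟨(2 * j - 1) * u - l * v, by linear_combination (2 * j - 1) * hu - l * hv⟩
      have x2 : L (2 * j - 1 - l) = L (-l * (2 * f j)) := hmod _ _
        ⟨(2 * j - 1) * u - l * v, by linear_combination (2 * j - 1) * hu - l * hv⟩
      rw [x1, x2]; simp
    · rw [tt_eps_neg p q (2 * j - 1) (v - 1) (2 * p - (2 * f j - 1)) (by linear_combination hv)
        (by omega) (by omega)]
      have x1 : L (2 * j - 1 + l) = L (-l * (2 * f j)) := by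
        rw [← heven (-l * (2 * f j))]
        exact hmod _ _
          ⟨(2 * j - 1) * u - l * v, by linear_combination (2 * j - 1) * hu - l * hv⟩
      have x2 : L (2 * j - 1 - l) = L (-l * (2 * f j - 2)) := by
        rw [← heven (-l * (2 * f j - 2))]
        exact hmod _ _
          ⟨(2 * j - 1) * u - l * v, by linear_combination (2 * j - 1) * hu - l * hv⟩
      rw [x1, x2]; push_cast; ring

/-- The sign `(-1)^k` in a commutative ring. -/
noncomputable def tt_sg (R : Type*) [CommRing R] (k : ℤ) : R :=
  ((((-1 : ℤˣ) ^ k : ℤˣ) : ℤ) : R)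

lemma tt_sg_sub_one (R : Type*) [CommRing R] (k : ℤ) : tt_sg R (k - 1) = - tt_sg R k := by
  simp [tt_sg, zpow_sub]

lemma tt_sg_even (R : Type*) [CommRing R] (k : ℤ) (h : Even k) : tt_sg R k = 1 := by
  simp [tt_sg, h.neg_one_zpow]

lemma tt_sg_odd (R : Type*) [CommRing R] (k : ℤ) (h : Odd k) : tt_sg R k = -1 := by
  simp [tt_sg, h.neg_one_zpow]

lemma tt_main {R : Type*} [CommRing R] (p q l : ℤ) (hp : Odd p) (hq : Odd q) (hp1 : 1 < p)
    (hcop : IsCoprime p q) (hlo : Odd l) (hl : 2 * p ∣ q * l + 1)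
    (x : R) (P Q : ℤ → R)
    (hP0 : P 0 = 1) (hP1 : P (-1) = 0)
    (hQ0 : Q 0 = 0) (hQ1 : Q (-1) = 1)
    (hPrec : ∀ k : ℤ, P k = (eps p q k : R) * x * P (k - 1) + P (k - 2))
    (hQrec : ∀ k : ℤ, Q k = (eps p q k : R) * x * Q (k - 1) + Q (k - 2))
    (hz : P (p - 1) = 0) :
    P (l - 1) * (Q (p - 2) - x * ∑ k ∈ Finset.Icc (1 : ℤ) ((p - 1) / 2),
            (eps p q (2 * k - 1) : R) * (P (2 * k - 1) + P (2 * k - 3))) = 2 := by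
  have hp0 : 0 < p := by omega
  have hnd : ∀ k, 1 ≤ k → k ≤ p - 1 → ¬ p ∣ k := by
    intro k h1 h2 hd
    have := Int.le_of_dvd (by omega) hd
    omega
  have hPm2 : P (-2) = 1 := by
    have := hPrec 0
    simp only [zero_sub, hP1, hP0, mul_zero, zero_add] at this
    exact this.symm
  -- shift by p
  have hshift : ∀ j, P (p + j) = P (p - 2) * tt_sg R j * P j := by
    apply tt_uniq_all (fun k => -(eps p q k : R) * x)
    · intro k
      have := hPrec (p + k)
      rw [add_comm p k, tt_eps_add_p p q k hp0 hq] at this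
      rw [add_comm p k, this, show k + p - 1 = p + (k - 1) by ring,
        show k + p - 2 = p + (k - 2) by ring]
      push_cast; ring
    · intro k
      have e2 : tt_sg R (k - 2) = tt_sg R k := by
        rw [show k - 2 = k - 1 - 1 by ring, tt_sg_sub_one, tt_sg_sub_one, neg_neg]
      rw [tt_sg_sub_one, e2]
      linear_combination P (p - 2) * tt_sg R k * hPrec k
    · have := hPrec p
      rw [hz] at this
      rw [add_zero, this, hP0, tt_sg_even R 0 (by simp)]; ring
    · rw [hP1, ← sub_eq_add_neg, hz]; ring
  -- partial symmetry
  have hsym0 : ∀ k, -1 ≤ k → k ≤ p - 1 → P (-2 - k) = P k := by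
    apply tt_uniq (fun k => (eps p q k : R) * x) (fun k => P (-2 - k)) P (p - 1)
    · intro k h1 h2
      have := hPrec (-k)
      rw [tt_eps_neg_arg p q k hp0 hcop (hnd k h1 h2)] at this
      rw [show -2 - (k - 1) = -k - 1 by ring, show -2 - (k - 2) = -k by ring,
        show -2 - k = -k - 2 by ring, this]
      push_cast; ring
    · intro k _ _; exact hPrec k
    · simp [hPm2, hP0]
    · norm_num
  have hi : P (p - 2) * P (p - 2) = -1 := by
    have h1 := hshift (-p)
    have h2 := hsym0 (p - 2) (by omega) (by omega)
    rw [show -2 - (p - 2) = -p by ring] at h2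
    rw [add_neg_cancel, hP0, h2, tt_sg_odd R _ hp.neg] at h1
    linear_combination h1
  have hper1 : Function.Periodic P (2 * p) := by
    intro k
    rw [show k + 2 * p = p + (p + k) by ring, hshift, hshift]
    rcases Int.even_or_odd k with h | h
    · rw [tt_sg_even R k h, tt_sg_odd R (p + k) (hp.add_even h)]
      linear_combination -P k * hi
    · rw [tt_sg_odd R k h, tt_sg_even R (p + k) (hp.add_odd h)]
      linear_combination -P k * hi
  have hper : ∀ k m : ℤ, P (k + 2 * p * m) = P k := by
    intro k m
    have := hper1.int_mul m k
    rw [mul_comm] at this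
    simpa using this
  have hsym : ∀ k, P (-2 - k) = P k := by
    intro k
    obtain ⟨t, s, h, h0, h1⟩ := tt_decomp p (k + 1) hp0
    by_cases hs : s ≤ p
    · rw [show k = (s - 1) + 2 * p * t by linear_combination h, hper,
        show -2 - (s - 1 + 2 * p * t) = (-2 - (s - 1)) + 2 * p * (-t) by ring, hper]
      exact hsym0 _ (by omega) (by omega)
    · have := hsym0 (-2 - (s - 1 - 2 * p)) (by omega) (by omega)
      rw [show k = (s - 1 - 2 * p) + 2 * p * (t + 1) by linear_combination h, hper,
        show -2 - (s - 1 - 2 * p + 2 * p * (t + 1)) = (-2 - (s - 1 - 2 * p)) + 2 * p * (-(t + 1))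
          by ring, hper, ← this]
      congr 1; ring
  -- the key relation
  have hkey : ∀ k, -1 ≤ k → k ≤ p - 1 → P (k + l) - P (k - l) = -P (l - 1) * x * P k := by
    apply tt_uniq (fun k => (eps p q k : R) * x) (fun k => P (k + l) - P (k - l))
      (fun k => -P (l - 1) * x * P k) (p - 1)
    · intro k h1 h2
      have a := hPrec (k + l)
      rw [tt_eps_shift p q l k hp0 hcop hl (hnd k h1 h2)] at a
      have b := hPrec (-k + l)
      rw [tt_eps_shift p q l (-k) hp0 hcop hl (by rw [dvd_neg]; exact hnd k h1 h2),
        tt_eps_neg_arg p q k hp0 hcop (hnd k h1 h2), ← hsym (-k + l), ← hsym (-k + l - 1),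
        ← hsym (-k + l - 2), show -2 - (-k + l) = k - 2 - l by ring,
        show -2 - (-k + l - 1) = k - 1 - l by ring, show -2 - (-k + l - 2) = k - l by ring] at b
      rw [show k + l - 1 = k - 1 + l by ring, show k + l - 2 = k - 2 + l by ring] at a
      push_cast at b
      linear_combination a + b
    · intro k _ _
      linear_combination (-P (l - 1) * x) * hPrec k
    · have a := hPrec l
      rw [tt_eps_l p q l hp1 hl, ← hsym (l - 2), show -2 - (l - 2) = -l by ring] at a
      simp only [zero_add, zero_sub, hP0]
      push_cast at a
      linear_combination a
    · have := hsym (-1 - l)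
      rw [show -2 - (-1 - l) = -1 + l by ring] at this
      simp only [hP1, this]; ring
  -- T = aP + bQ
  have hT : ∀ k, -1 ≤ k → k ≤ p - 1 → P (k + l) = P l * P k + P (l - 1) * Q k := by
    apply tt_uniq (fun k => (eps p q k : R) * x) (fun k => P (k + l))
      (fun k => P l * P k + P (l - 1) * Q k) (p - 1)
    · intro k h1 h2
      have a := hPrec (k + l)
      rw [tt_eps_shift p q l k hp0 hcop hl (hnd k h1 h2),
        show k + l - 1 = k - 1 + l by ring, show k + l - 2 = k - 2 + l by ring] at a
      exact a
    · intro k _ _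
      linear_combination P l * hPrec k + P (l - 1) * hQrec k
    · simp [hP0, hQ0]
    · simp only [hP1, hQ1, show -1 + l = l - 1 by ring]; ring
  have hsum := tt_sum p q l hp hp1 hq hcop hlo hl (fun k => P k + P (k - 2))
    (by
      intro k m
      rw [hper, show k + 2 * p * m - 2 = (k - 2) + 2 * p * m by ring, hper])
    (by
      intro k
      rw [← hsym k, ← hsym (k - 2), show -2 - k = -k - 2 by ring,
        show -2 - (k - 2) = -k by ring]; ring)
  simp only [zero_sub, hP0, hPm2] at hsum
  have hsum2 : -P (l - 1) * x * ∑ k ∈ Finset.Icc (1 : ℤ) ((p - 1) / 2),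
            (eps p q (2 * k - 1) : R) * (P (2 * k - 1) + P (2 * k - 3)) =
      1 + 1 - (P (p + l) + P (p + l - 2)) := by
    rw [← hsum, Finset.mul_sum]
    refine Finset.sum_congr rfl fun j hj => ?_
    rw [Finset.mem_Icc] at hj
    have a := hkey (2 * j - 1) (by omega) (by omega)
    have b := hkey (2 * j - 3) (by omega) (by omega)
    rw [show 2 * j - 1 + l - 2 = 2 * j - 3 + l by ring,
      show 2 * j - 1 - l - 2 = 2 * j - 3 - l by ring]
    linear_combination -(eps p q (2 * j - 1) : R) * (a + b)
  have h1 := hT (p - 2) (by omega) (by omega)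
  have h2 := hshift l
  rw [tt_sg_odd R l hlo] at h2
  rw [show p - 2 + l = p + l - 2 by ring] at h1
  linear_combination hsum2 - h1 - h2

/-- The key identity `P_{ℓ′−1} (Q_{p−2} − X Σ_{k=1}^{(p−1)/2} ε_{2k−1}(P_{2k−1}+P_{2k−3})) ≡ 2
mod `P_{p−1}`, i.e. the torsion `τ₁` of `K(p,q)` equals `2/(x² P_{ℓ−1})`. -/
theorem torsion_tau1_identity (p q ℓ' : ℤ) (hp : Odd p) (hq : Odd q) (hq0 : 0 < q) (hqp : q < p)
    (hcop : IsCoprime p q)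
    (hℓodd : Odd ℓ') (hℓ0 : 0 < ℓ') (hℓ2p : ℓ' < 2 * p) (hℓ : 2 * p ∣ q * ℓ' + 1)
    (P Q : ℤ → Polynomial ℚ)
    (hP0 : P 0 = 1) (hP1 : P (-1) = 0)
    (hQ0 : Q 0 = 0) (hQ1 : Q (-1) = 1)
    (hPrec : ∀ k : ℤ, P k = C ((eps p q k : ℚ)) * X * P (k - 1) + P (k - 2))
    (hQrec : ∀ k : ℤ, Q k = C ((eps p q k : ℚ)) * X * Q (k - 1) + Q (k - 2)) :
    P (p - 1) ∣
      (P (ℓ' - 1) *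
        (Q (p - 2) -
          X * ∑ k ∈ Finset.Icc (1 : ℤ) ((p - 1) / 2),
            C ((eps p q (2 * k - 1) : ℚ)) * (P (2 * k - 1) + P (2 * k - 3))) - 2) := by
  have hz : (Ideal.Quotient.mk (Ideal.span {P (p - 1)})) (P (p - 1)) = 0 :=
    Ideal.Quotient.eq_zero_iff_mem.2 (Ideal.mem_span_singleton_self _)
  rw [← Ideal.mem_span_singleton, ← Ideal.Quotient.eq_zero_iff_mem]
  have hC : ∀ k, (Ideal.Quotient.mk (Ideal.span {P (p - 1)})) (C ((eps p q k : ℚ))) =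
      (eps p q k : ℚ[X] ⧸ Ideal.span {P (p - 1)}) := by
    intro k
    simp
  have := tt_main p q ℓ' hp hq (by omega) hcop hℓodd hℓ
    (Ideal.Quotient.mk (Ideal.span {P (p - 1)}) X)
    (fun k => Ideal.Quotient.mk (Ideal.span {P (p - 1)}) (P k))
    (fun k => Ideal.Quotient.mk (Ideal.span {P (p - 1)}) (Q k))
    (by simp only [hP0, map_one]) (by simp only [hP1, map_zero])
    (by simp only [hQ0, map_zero]) (by simp only [hQ1, map_one])
    (by
      intro k
      rw [← hC, ← map_mul, ← map_mul, ← map_add, ← hPrec k])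
    (by
      intro k
      rw [← hC, ← map_mul, ← map_mul, ← map_add, ← hQrec k]) hz
  rw [map_sub, sub_eq_zero, map_mul, map_sub, map_mul, map_sum]
  simp only [map_mul, map_add, hC]
  rw [this, map_ofNat]
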